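/- arXiv:2406.08945 — 5 statements merged into one kernel-verified Lean document; each statement's English description precedes it below -/
import Mathlib

section
/- Let (X, Σ) be a measurable space, μ a finite measure on it, and 𝓘 ⊆ Σ a nonempty family of measurable sets satisfying (I0), (I1) and (I2). Then the setfunction r defined on Σ by r(A) = sup{ μ(I) : I ∈ 𝓘, I ⊆ A } is submodular, i.e. r(A) + r(B) ≥ r(A ∪ B) + r(A ∩ B) for all A, B ∈ Σ. -/
open MeasureTheory Set

lemma exists_max_ext {X : Type*} [MeasurableSpace X] (μ : Measure X) [IsFiniteMeasure μ]
    (𝓘 : Set (Set X))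
    (hI1 : ∀ I : ℕ → Set X, (∀ n, I n ∈ 𝓘) → (∀ n, I n ⊆ I (n + 1)) → (⋃ n, I n) ∈ 𝓘)
    (hI2 : ∀ I₁ ∈ 𝓘, ∀ I₂ ∈ 𝓘, μ I₁ < μ I₂ →
      ∃ I₃ ∈ 𝓘, I₁ ⊆ I₃ ∧ I₃ ⊆ I₁ ∪ I₂ ∧ μ I₁ < μ I₃)
    (A I : Set X) (hI : I ∈ 𝓘) (hIA : I ⊆ A) :
    ∃ J ∈ 𝓘, I ⊆ J ∧ J ⊆ A ∧ ∀ K ∈ 𝓘, K ⊆ A → μ K ≤ μ J := by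
  have step : ∀ (n : ℕ) (J : {J : Set X // J ∈ 𝓘 ∧ J ⊆ A}),
      ∃ K : {J : Set X // J ∈ 𝓘 ∧ J ⊆ A}, J.1 ⊆ K.1 ∧
        ∀ L ∈ 𝓘, L ⊆ A → J.1 ⊆ L → μ.real L ≤ μ.real K.1 + 1 / ((n : ℝ) + 1) := by
    intro n J
    let S : Set ℝ := {x | ∃ L ∈ 𝓘, L ⊆ A ∧ J.1 ⊆ L ∧ x = μ.real L}
    have hne : S.Nonempty := ⟨_, J.1, J.2.1, J.2.2, subset_rfl, rfl⟩
    have hb : BddAbove S := by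
      refine ⟨μ.real univ, ?_⟩
      rintro x ⟨L, _, _, _, rfl⟩
      exact measureReal_mono (subset_univ _)
    have hpos : (0 : ℝ) < 1 / ((n : ℝ) + 1) := by positivity
    obtain ⟨x, ⟨K, hK, hKA, hJK, rfl⟩, hx⟩ := exists_lt_of_lt_csSup hne (sub_lt_self (sSup S) hpos)
    refine ⟨⟨K, hK, hKA⟩, hJK, fun L hL hLA hJL => ?_⟩
    have := le_csSup hb (show μ.real L ∈ S from ⟨L, hL, hLA, hJL, rfl⟩)
    simp only
    linarith
  choose f hf1 hf2 using step
  let g : ℕ → {J : Set X // J ∈ 𝓘 ∧ J ⊆ A} := fun n => Nat.rec ⟨I, hI, hIA⟩ (fun n J => f n J) n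
  have hg : ∀ n, g (n + 1) = f n (g n) := fun n => rfl
  have hU : (⋃ n, (g n).1) ∈ 𝓘 := hI1 _ (fun n => (g n).2.1) (fun n => by rw [hg]; exact hf1 _ _)
  have hUA : (⋃ n, (g n).1) ⊆ A := iUnion_subset fun n => (g n).2.2
  refine ⟨_, hU, subset_iUnion (fun n => (g n).1) 0, hUA, fun K hK hKA => ?_⟩
  by_contra! hlt
  obtain ⟨L, hL, hUL, hLU, hlt'⟩ := hI2 _ hU K hK hlt
  have hlt2 : μ.real (⋃ n, (g n).1) < μ.real L :=
    (ENNReal.toReal_lt_toReal (measure_ne_top _ _) (measure_ne_top _ _)).2 hlt'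
  obtain ⟨n, hn⟩ := exists_nat_one_div_lt (sub_pos.2 hlt2)
  have h1 := hf2 n (g n) L hL (hLU.trans (union_subset hUA hKA))
    ((subset_iUnion (fun n => (g n).1) n).trans hUL)
  have h2 : μ.real (f n (g n)).1 ≤ μ.real (⋃ n, (g n).1) :=
    measureReal_mono (subset_iUnion (fun n => (g n).1) (n + 1))
  linarith

/-- If `𝓘` is a nonempty family of measurable sets satisfying (I0), (I1), (I2)
with respect to a finite measure `μ`, then `r A = sup { μ I : I ∈ 𝓘, I ⊆ A }` is submodular. -/
theorem submodular_of_measurable_matroid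
    {X : Type*} [MeasurableSpace X] (μ : Measure X) [IsFiniteMeasure μ]
    (𝓘 : Set (Set X)) (h𝓘meas : ∀ I ∈ 𝓘, MeasurableSet I) (h𝓘ne : 𝓘.Nonempty)
    (hI0 : ∀ I ∈ 𝓘, ∀ J : Set X, MeasurableSet J → J ⊆ I → J ∈ 𝓘)
    (hI1 : ∀ I : ℕ → Set X, (∀ n, I n ∈ 𝓘) → (∀ n, I n ⊆ I (n + 1)) → (⋃ n, I n) ∈ 𝓘)
    (hI2 : ∀ I₁ ∈ 𝓘, ∀ I₂ ∈ 𝓘, μ I₁ < μ I₂ →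
      ∃ I₃ ∈ 𝓘, I₁ ⊆ I₃ ∧ I₃ ⊆ I₁ ∪ I₂ ∧ μ I₁ < μ I₃)
    (r : Set X → ℝ)
    (hr : ∀ A : Set X, MeasurableSet A →
      r A = sSup {x : ℝ | ∃ I ∈ 𝓘, I ⊆ A ∧ x = (μ I).toReal}) :
    ∀ A B : Set X, MeasurableSet A → MeasurableSet B →
      r (A ∪ B) + r (A ∩ B) ≤ r A + r B := by
  intro A B hA hB
  have hbd : ∀ A : Set X, BddAbove {x : ℝ | ∃ I ∈ 𝓘, I ⊆ A ∧ x = (μ I).toReal} := by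
    intro A
    refine ⟨μ.real univ, ?_⟩
    rintro x ⟨L, _, _, rfl⟩
    exact measureReal_mono (subset_univ _)
  have hle : ∀ A, MeasurableSet A → ∀ J ∈ 𝓘, J ⊆ A → μ.real J ≤ r A := by
    intro A hA J hJ hJA
    rw [hr A hA]
    exact le_csSup (hbd A) ⟨J, hJ, hJA, rfl⟩
  have hge : ∀ A, MeasurableSet A → ∀ J ∈ 𝓘, J ⊆ A → (∀ K ∈ 𝓘, K ⊆ A → μ K ≤ μ J) →
      r A ≤ μ.real J := by
    intro A hA J hJ hJA h
    rw [hr A hA]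
    refine csSup_le ⟨_, J, hJ, hJA, rfl⟩ ?_
    rintro x ⟨K, hK, hKA, rfl⟩
    exact ENNReal.toReal_mono (measure_ne_top _ _) (h K hK hKA)
  obtain ⟨I, hI⟩ := h𝓘ne
  have hempty : ∅ ∈ 𝓘 := hI0 I hI ∅ MeasurableSet.empty (empty_subset _)
  obtain ⟨J₀, hJ₀, -, hJ₀A, hmax₀⟩ :=
    exists_max_ext μ 𝓘 hI1 hI2 (A ∩ B) ∅ hempty (empty_subset _)
  obtain ⟨J, hJ, hJJ, hJA, hmax⟩ :=
    exists_max_ext μ 𝓘 hI1 hI2 (A ∪ B) J₀ hJ₀ (hJ₀A.trans (inter_subset_left.trans subset_union_left))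
  have hJm := h𝓘meas J hJ
  have e1 := hge _ (hA.inter hB) J₀ hJ₀ hJ₀A hmax₀
  have e2 := hge _ (hA.union hB) J hJ hJA hmax
  have e3 := hle A hA (J ∩ A) (hI0 J hJ _ (hJm.inter hA) inter_subset_left) inter_subset_right
  have e4 := hle B hB (J ∩ B) (hI0 J hJ _ (hJm.inter hB) inter_subset_left) inter_subset_right
  have e5 := measureReal_union_add_inter (μ := μ) (s := J ∩ A) (t := J ∩ B) (hJm.inter hB)
  have e6 : (J ∩ A) ∪ (J ∩ B) = J := by
    rw [← inter_union_distrib_left]; exact inter_eq_left.2 hJA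
  have e7 : μ.real J₀ ≤ μ.real ((J ∩ A) ∩ (J ∩ B)) := measureReal_mono
    (fun x hx => ⟨⟨hJJ hx, (hJ₀A hx).1⟩, ⟨hJJ hx, (hJ₀A hx).2⟩⟩)
  rw [e6] at e5
  linarith
end

section
/- Let (X, Σ) be a measurable space, μ a finite measure on it, and 𝓘 ⊆ Σ a family of measurable sets satisfying (I1). Then 𝓘 satisfies (I2) if and only if 𝓘 satisfies (I2'). -/
open MeasureTheory Set

/-- For a family `𝓘` of measurable sets satisfying (I1) with respect to a finite
measure `μ`, the exchange axioms (I2) and (I2') are equivalent. -/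
theorem exchange_axioms_equivalent
    {X : Type*} [MeasurableSpace X] (μ : Measure X) [IsFiniteMeasure μ]
    (𝓘 : Set (Set X)) (h𝓘meas : ∀ I ∈ 𝓘, MeasurableSet I)
    (hI1 : ∀ I : ℕ → Set X, (∀ n, I n ∈ 𝓘) → (∀ n, I n ⊆ I (n + 1)) → (⋃ n, I n) ∈ 𝓘) :
    (∀ I₁ ∈ 𝓘, ∀ I₂ ∈ 𝓘, μ I₁ < μ I₂ →
      ∃ I₃ ∈ 𝓘, I₁ ⊆ I₃ ∧ I₃ ⊆ I₁ ∪ I₂ ∧ μ I₁ < μ I₃) ↔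
    (∀ I₁ ∈ 𝓘, ∀ I₂ ∈ 𝓘,
      ∃ I₃ ∈ 𝓘, I₁ ⊆ I₃ ∧ I₃ ⊆ I₁ ∪ I₂ ∧ μ I₂ ≤ μ I₃) := by
  constructor
  · intro h I₁ h₁ I₂ h₂
    let P : Set (Set X) := {B | B ∈ 𝓘 ∧ I₁ ⊆ B ∧ B ⊆ I₁ ∪ I₂}
    have step : ∀ (n : ℕ) (A : P), ∃ A' : P, A.1 ⊆ A'.1 ∧
        ∀ B ∈ P, A.1 ⊆ B → μ.real B ≤ μ.real A'.1 + 1 / ((n : ℝ) + 1) := by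
      intro n A
      let S : Set ℝ := {r | ∃ B ∈ P, A.1 ⊆ B ∧ μ.real B = r}
      have hne : S.Nonempty := ⟨_, A.1, A.2, subset_rfl, rfl⟩
      have hbd : BddAbove S := by
        refine ⟨μ.real univ, ?_⟩
        rintro r ⟨B, _, _, rfl⟩
        exact measureReal_mono (subset_univ _)
      have hpos : (0 : ℝ) < 1 / ((n : ℝ) + 1) := by positivity
      obtain ⟨r, ⟨A', hA', hs, rfl⟩, hlt⟩ :=
        exists_lt_of_lt_csSup hne (sub_lt_self (sSup S) hpos)
      refine ⟨⟨A', hA'⟩, hs, fun B hB hAB => ?_⟩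
      have := le_csSup hbd (show μ.real B ∈ S from ⟨B, hB, hAB, rfl⟩)
      simp only
      linarith
    choose f hf1 hf2 using step
    let A : ℕ → P := fun n => Nat.rec ⟨I₁, h₁, subset_rfl, subset_union_left⟩ (fun k a => f k a) n
    have hA : ∀ n, A (n + 1) = f n (A n) := fun n => rfl
    have hMI : (⋃ n, (A n).1) ∈ 𝓘 :=
      hI1 (fun n => (A n).1) (fun n => (A n).2.1) (fun n => hf1 n (A n))
    have hM1 : I₁ ⊆ ⋃ n, (A n).1 := subset_iUnion_of_subset 0 (A 0).2.2.1
    have hM2 : (⋃ n, (A n).1) ⊆ I₁ ∪ I₂ := iUnion_subset fun n => (A n).2.2.2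
    refine ⟨_, hMI, hM1, hM2, ?_⟩
    by_contra hlt
    obtain ⟨B, hB, hMB, hBU, hgt⟩ := h _ hMI I₂ h₂ (not_le.mp hlt)
    have hBP : B ∈ P :=
      ⟨hB, hM1.trans hMB, hBU.trans (union_subset hM2 subset_union_right)⟩
    have hgt' : μ.real (⋃ n, (A n).1) < μ.real B :=
      (ENNReal.toReal_lt_toReal (measure_ne_top _ _) (measure_ne_top _ _)).2 hgt
    obtain ⟨n, hn⟩ := exists_nat_one_div_lt (sub_pos.2 hgt')
    have e1 := hf2 n (A n) B hBP ((subset_iUnion (fun n => (A n).1) n).trans hMB)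
    have e2 : μ.real (f n (A n)).1 ≤ μ.real (⋃ n, (A n).1) :=
      measureReal_mono (subset_iUnion (fun n => (A n).1) (n + 1))
    linarith
  · intro h I₁ h₁ I₂ h₂ hlt
    obtain ⟨I₃, h₃, a, b, c⟩ := h I₁ h₁ I₂ h₂
    exact ⟨I₃, h₃, a, b, hlt.trans_le c⟩
end

section
/- Let G be a finite simple graph whose girth g is finite (i.e. G contains a cycle), and let F ⊆ E(G) be any set of edges. Let m₀ and m₁ denote the number of vertices that are incident to exactly 0, respectively exactly 1, edge of F. Then the number of connected components of the spanning subgraph (V(G), F) is at most m₀ + m₁/2 + |V(G)|/g. -/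
open SimpleGraph Set

lemma ccb_one {V : Type*} (G : SimpleGraph V)
    (F : Set (Sym2 V)) (hF : F ⊆ G.edgeSet)
    (C : (SimpleGraph.fromEdgeSet F).ConnectedComponent) (v : C)
    (h : ∃! w, C.toSimpleGraph.Adj v w) : Set.ncard {e ∈ F | (v : V) ∈ e} = 1 := by
  obtain ⟨w, hw, hu⟩ := h
  rw [Set.ncard_eq_one]
  refine ⟨s(↑v, ↑w), ?_⟩
  have hw' : (SimpleGraph.fromEdgeSet F).Adj v w := hw
  ext e
  constructor
  · rintro ⟨he, hve⟩
    obtain ⟨x, rfl⟩ := Sym2.mem_iff_exists.1 hve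
    have hne : (v : V) ≠ x := G.ne_of_adj (hF he)
    have ha : (SimpleGraph.fromEdgeSet F).Adj v x := by
      simp [he, hne]
    have hx : x ∈ C.supp := C.mem_supp_of_adj_mem_supp v.2 ha
    have := hu ⟨x, hx⟩ ha
    subst this
    rfl
  · rintro rfl
    exact ⟨((fromEdgeSet_adj F).1 hw').1, Sym2.mem_mk_left _ _⟩

lemma ccb_cycle {V : Type*} [Fintype V] (H : SimpleGraph V) {v : V} (w : H.Walk v v)
    (hw : w.IsCycle) : w.length ≤ Fintype.card V := by
  have h := hw.support_nodup
  have := h.length_le_card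
  simpa using this

lemma ccb_comp {V : Type*} [Fintype V] (G : SimpleGraph V) 
    (F : Set (Sym2 V)) (hF : F ⊆ G.edgeSet)
    (C : (SimpleGraph.fromEdgeSet F).ConnectedComponent) :
    (∃ v ∈ C, ∀ e ∈ F, v ∉ e) ∨ 
    (∃ v ∈ C, ∃ w ∈ C, v ≠ w ∧ Set.ncard {e ∈ F | v ∈ e} = 1 ∧ Set.ncard {e ∈ F | w ∈ e} = 1) ∨
    G.girth ≤ Nat.card C := by
  classical
  by_cases hac : C.toSimpleGraph.IsAcyclic
  · have ht : C.toSimpleGraph.IsTree := ⟨C.connected_toSimpleGraph, hac⟩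
    rcases subsingleton_or_nontrivial C with hs | hn
    · left
      obtain ⟨v, hv⟩ := C.nonempty_supp
      refine ⟨v, hv, fun e he hve => ?_⟩
      obtain ⟨x, rfl⟩ := Sym2.mem_iff_exists.1 hve
      have hne : v ≠ x := G.ne_of_adj (hF he)
      have ha : (SimpleGraph.fromEdgeSet F).Adj v x := by
        simp [he, hne]
      have hx : x ∈ C.supp := C.mem_supp_of_adj_mem_supp hv ha
      exact hne (congrArg Subtype.val (hs.elim ⟨v, hv⟩ ⟨x, hx⟩))
    · right; left
      obtain ⟨u, v, hne, hu, hv⟩ := ht.exists_ne_and_degree_eq_one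
      exact ⟨u, u.2, v, v.2, fun h => hne (Subtype.ext h),
        ccb_one G F hF C u (degree_eq_one_iff_existsUnique_adj.1 hu),
        ccb_one G F hF C v (degree_eq_one_iff_existsUnique_adj.1 hv)⟩
  · right; right
    simp only [IsAcyclic, not_forall, not_not] at hac
    obtain ⟨v, w, hw⟩ := hac
    have h1 := ccb_cycle _ w hw
    have hle : SimpleGraph.fromEdgeSet F ≤ G := fun a b h => hF ((fromEdgeSet_adj F).1 h).1
    have hw2 := (hw.map (f := C.toSimpleGraph_hom) Subtype.val_injective).mapLe hle
    have h2 := girth_le_length hw2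
    rw [Nat.card_eq_fintype_card]
    simp only [Walk.mapLe, Walk.length_map] at h2
    exact h2.trans h1

/-- For a finite simple graph `G` with finite girth `g`, and an edge set
`F ⊆ E(G)`, the number of connected components of the spanning subgraph `(V(G), F)` is
at most `m₀ + m₁/2 + |V(G)|/g`, where `m₀` (resp. `m₁`) is the number of vertices incident
to exactly `0` (resp. exactly `1`) edges of `F`. -/
theorem component_count_bound
    {V : Type*} [Fintype V] (G : SimpleGraph V) (hgirth : G.egirth ≠ ⊤)
    (F : Set (Sym2 V)) (hF : F ⊆ G.edgeSet)
    (m₀ m₁ : ℕ)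
    (hm₀ : m₀ = Set.ncard {v : V | ∀ e ∈ F, v ∉ e})
    (hm₁ : m₁ = Set.ncard {v : V | Set.ncard {e ∈ F | v ∈ e} = 1}) :
    (Nat.card (SimpleGraph.fromEdgeSet F).ConnectedComponent : ℝ) ≤
      (m₀ : ℝ) + (m₁ : ℝ) / 2 + (Fintype.card V : ℝ) / (G.girth : ℝ) := by
  classical
  have hg : 3 ≤ G.girth := three_le_girth (fun h => hgirth (egirth_eq_top.2 h))
  have hg0 : (0 : ℝ) < G.girth := by exact_mod_cast (by omega : 0 < G.girth)
  set a : V → ℝ := fun v => if ∀ e ∈ F, v ∉ e then 1 else 0 with ha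
  set b : V → ℝ := fun v => if Set.ncard {e ∈ F | v ∈ e} = 1 then 1 / 2 else 0 with hb
  set c : V → ℝ := fun v => 1 / (G.girth : ℝ) with hc
  have ha0 : ∀ v, 0 ≤ a v := fun v => by simp only [ha]; split_ifs <;> norm_num
  have hb0 : ∀ v, 0 ≤ b v := fun v => by simp only [hb]; split_ifs <;> norm_num
  have hc0 : ∀ v, 0 ≤ c v := fun v => by simp only [hc]; positivity
  have h1 : (m₀ : ℝ) = ∑ v, a v := by
    rw [hm₀, Set.ncard_eq_toFinset_card']
    simp [ha]
  have h2 : (m₁ : ℝ) / 2 = ∑ v, b v := by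
    rw [hm₁, Set.ncard_eq_toFinset_card']
    simp [hb, Finset.sum_ite, div_eq_mul_inv]
  have h3 : (Fintype.card V : ℝ) / (G.girth : ℝ) = ∑ v, c v := by
    simp [hc, div_eq_mul_inv]
  rw [h1, h2, h3, ← Finset.sum_add_distrib, ← Finset.sum_add_distrib,
    ← Finset.sum_fiberwise Finset.univ (SimpleGraph.fromEdgeSet F).connectedComponentMk,
    Nat.card_eq_fintype_card]
  have key : ∀ C : (SimpleGraph.fromEdgeSet F).ConnectedComponent, (1 : ℝ) ≤
      ∑ v with (SimpleGraph.fromEdgeSet F).connectedComponentMk v = C, (a v + b v + c v) := by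
    intro C
    rcases ccb_comp G F hF C with ⟨v, hv, h⟩ | ⟨v, hv, w, hw, hne, h, h'⟩ | h
    · refine le_trans ?_ (Finset.single_le_sum (f := fun v => a v + b v + c v) (a := v)
        (fun i _ => by linarith [ha0 i, hb0 i, hc0 i]) (Finset.mem_filter.2 ⟨Finset.mem_univ _, hv⟩))
      have : a v = 1 := by simp only [ha]; rw [if_pos h]
      linarith [hb0 v, hc0 v]
    · have hs : ({v, w} : Finset V) ⊆ 
          Finset.univ.filter (fun v => (SimpleGraph.fromEdgeSet F).connectedComponentMk v = C) := by
        intro x hx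
        simp only [Finset.mem_insert, Finset.mem_singleton] at hx
        rcases hx with rfl | rfl
        · exact Finset.mem_filter.2 ⟨Finset.mem_univ _, hv⟩
        · exact Finset.mem_filter.2 ⟨Finset.mem_univ _, hw⟩
      refine le_trans ?_ (Finset.sum_le_sum_of_subset_of_nonneg hs
        (fun i _ _ => by linarith [ha0 i, hb0 i, hc0 i]))
      rw [Finset.sum_pair hne]
      have e1 : b v = 1 / 2 := by simp only [hb]; rw [if_pos h]
      have e2 : b w = 1 / 2 := by simp only [hb]; rw [if_pos h']
      linarith [ha0 v, hc0 v, ha0 w, hc0 w]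
    · refine le_trans ?_ (Finset.sum_le_sum (f := c) (fun i _ => by linarith [ha0 i, hb0 i]))
      have hcard : (Finset.univ.filter
          (fun v => (SimpleGraph.fromEdgeSet F).connectedComponentMk v = C)).card = Nat.card C := by
        rw [Nat.card_eq_fintype_card, Fintype.card_subtype]
        rfl
      rw [Finset.sum_const, hcard, nsmul_eq_mul, mul_one_div, le_div_iff₀ hg0, one_mul]
      exact_mod_cast h
  calc _ = ∑ C : (SimpleGraph.fromEdgeSet F).ConnectedComponent, (1 : ℝ) := by simp
    _ ≤ _ := Finset.sum_le_sum (fun C _ => key C)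
end

section
/- Let n ≥ 1 and let G be a finite simple 3-regular graph on 2n vertices such that for every S ⊆ V(G) with |S| ≤ n, the number of edges of G with exactly one endpoint in S is at least c|S|, where 0 < c ≤ 1, and such that the girth of G is greater than 128/c. For F ⊆ E(G) let r(F) = 2n − c(F), where c(F) is the number of connected components of the spanning subgraph (V(G), F). Then for every partition E(G) = E₁ ∪ E₂ into two disjoint sets, max(|r(E₁) − n|, |r(E₂) − n|) ≥ cn/64. -/
open SimpleGraph Set

open Classical in
lemma aux_comp {V : Type*} [Fintype V] (H : SimpleGraph V) (C : H.ConnectedComponent)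
    (hC : C.toSimpleGraph.IsAcyclic) :
    ∑ v ∈ Finset.univ.filter (fun v => H.connectedComponentMk v = C), H.degree v + 2
      = 2 * (Finset.univ.filter (fun v => H.connectedComponentMk v = C)).card := by
  have ht : C.toSimpleGraph.IsTree := ⟨C.connected_toSimpleGraph, hC⟩
  have h1 := ht.card_edgeFinset
  have h2 := C.toSimpleGraph.sum_degrees_eq_twice_card_edges
  have h3 : ∀ v : C, C.toSimpleGraph.degree v = H.degree (v : V) := by
    intro v
    have : H.neighborSet (v : V) ⊆ C.supp := fun w hw =>
      C.mem_supp_of_adj_mem_supp v.2 hw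
    have := degree_induce_of_neighborSet_subset (G := H) (s := C.supp) (v := v) this
    rw [← this]
    unfold ConnectedComponent.toSimpleGraph
    convert rfl
    exact Iff.rfl
  have h4 : Fintype.card C = (Finset.univ.filter (fun v => H.connectedComponentMk v = C)).card := by
    rw [← Fintype.card_subtype]
    exact Fintype.card_congr (Equiv.refl _)
  have h5 : ∑ v ∈ Finset.univ.filter (fun v => H.connectedComponentMk v = C), H.degree v
      = ∑ v : C, C.toSimpleGraph.degree v := by
    simp_rw [h3]
    exact Finset.sum_subtype (p := fun v => v ∈ C) _ (by intro x; simp; rfl) (fun v => H.degree v)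
  rw [h5, h2, ← h4, ← h1]
  ring

open Classical in
lemma aux_big {V : Type*} [Fintype V] (H : SimpleGraph V) (C : H.ConnectedComponent) (L : ℝ)
    (hL : ∀ (v : V) (w : H.Walk v v), w.IsCycle → L ≤ w.length)
    (hC : ¬ C.toSimpleGraph.IsAcyclic) :
    L ≤ (Finset.univ.filter (fun v => H.connectedComponentMk v = C)).card := by
  unfold IsAcyclic at hC
  push Not at hC
  obtain ⟨v, w, hw⟩ := hC
  have hinj : Function.Injective C.toSimpleGraph_hom := Subtype.val_injective
  have h1 := hL _ _ (hw.map hinj)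
  rw [Walk.length_map] at h1
  have h4 : Fintype.card C = (Finset.univ.filter (fun v => H.connectedComponentMk v = C)).card := by
    rw [← Fintype.card_subtype]
    exact Fintype.card_congr (Equiv.refl _)
  rw [← h4]
  refine h1.trans ?_
  have h5 := hw.support_nodup.length_le_card
  rw [List.length_tail, Walk.length_support] at h5
  exact_mod_cast h5

open Classical in
lemma aux_main {V : Type*} [Fintype V] (H : SimpleGraph V) (L : ℝ)
    (hL : ∀ (v : V) (w : H.Walk v v), w.IsCycle → L ≤ w.length) :
    ∃ (T : Finset V) (t : ℕ), (∀ u v, H.Adj u v → (u ∈ T ↔ v ∈ T)) ∧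
      ∑ v ∈ T, H.degree v + 2 * t = 2 * T.card ∧
      ((Nat.card H.ConnectedComponent : ℝ) - t) * L ≤ Fintype.card V := by
  let A : Finset H.ConnectedComponent := Finset.univ.filter (fun C => C.toSimpleGraph.IsAcyclic)
  let f : V → H.ConnectedComponent := H.connectedComponentMk
  refine ⟨Finset.univ.filter (fun v => f v ∈ A), A.card, ?_, ?_, ?_⟩
  · intro u v huv
    have : f u = f v := ConnectedComponent.connectedComponentMk_eq_of_adj huv
    simp [this]
  · have hm : ∀ v ∈ Finset.univ.filter (fun v => f v ∈ A), f v ∈ A := by simp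
    rw [Finset.card_eq_sum_card_fiberwise hm, ← Finset.sum_fiberwise_of_maps_to hm, mul_comm 2,
      ← smul_eq_mul, ← Finset.sum_const, ← Finset.sum_add_distrib, Finset.mul_sum]
    refine Finset.sum_congr rfl fun C hC => ?_
    have := aux_comp H C (by simpa [A] using hC)
    have e : (Finset.univ.filter (fun v => f v ∈ A)).filter (fun v => f v = C)
        = Finset.univ.filter (fun v => H.connectedComponentMk v = C) := by
      ext v
      simp only [Finset.mem_filter, Finset.mem_univ, true_and]
      constructor
      · exact fun h => h.2
      · exact fun h => ⟨by rw [show f v = C from h]; exact hC, h⟩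
    rw [e]
    exact this
  · have h1 : (Aᶜ.card : ℝ) * L ≤ ∑ C ∈ Aᶜ,
        ((Finset.univ.filter (fun v => H.connectedComponentMk v = C)).card : ℝ) := by
      rw [← nsmul_eq_mul, ← Finset.sum_const]
      exact Finset.sum_le_sum fun C hC => aux_big H C L hL (by simpa [A] using hC)
    have h2 : ∑ C ∈ Aᶜ, (Finset.univ.filter (fun v => H.connectedComponentMk v = C)).card
        ≤ Fintype.card V := by
      rw [← Finset.card_univ, Finset.card_eq_sum_card_fiberwise (f := f) (t := Finset.univ)
        (by intro x _; simp)]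
      exact Finset.sum_le_sum_of_subset (Finset.subset_univ _)
    have h3 : A.card + Aᶜ.card = Nat.card H.ConnectedComponent := by
      rw [Finset.card_add_card_compl, Nat.card_eq_fintype_card]
    have h4 : (Nat.card H.ConnectedComponent : ℝ) - A.card = Aᶜ.card := by
      rw [← h3]; push_cast; ring
    rw [h4]
    refine h1.trans ?_
    exact_mod_cast h2


/-- On a `3`-regular `c`-edge-expander `G` with `2n` vertices and girth
greater than `128/c`, no 2-partition `E(G) = E₁ ∪ E₂` of the edge set has both ranks
`r(Eᵢ)` within `cn/64` of `n`, where `r(F) = 2n − c(F)` is the cycle-matroid rank. -/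
theorem expander_rank_not_balanced
    {V : Type*} [Fintype V] [DecidableEq V] (G : SimpleGraph V) [DecidableRel G.Adj]
    (n : ℕ) (hn : 1 ≤ n) (hcard : Fintype.card V = 2 * n)
    (hreg : ∀ v : V, G.degree v = 3)
    (c : ℝ) (hc0 : 0 < c) (hc1 : c ≤ 1)
    (hexp : ∀ S : Finset V, S.card ≤ n →
      c * (S.card : ℝ) ≤
        (Set.ncard {e : Sym2 V | e ∈ G.edgeSet ∧ ∃ u v : V, e = s(u, v) ∧ u ∈ S ∧ v ∉ S} : ℝ))
    (hgirth : ∀ m : ℕ, G.egirth ≤ (m : ℕ∞) → 128 / c < (m : ℝ))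
    (r : Set (Sym2 V) → ℝ)
    (hr : ∀ F : Set (Sym2 V),
      r F = 2 * (n : ℝ) - (Nat.card (SimpleGraph.fromEdgeSet F).ConnectedComponent : ℝ)) :
    ∀ E₁ E₂ : Set (Sym2 V), E₁ ∪ E₂ = G.edgeSet → Disjoint E₁ E₂ →
      c * n / 64 ≤ max |r E₁ - n| |r E₂ - n| := by
  classical
  intro E₁ E₂ hU hD
  by_contra hlt
  rw [not_le, max_lt_iff, hr, hr] at hlt
  obtain ⟨hl1, hl2⟩ := hlt
  have hl1 := (abs_lt.1 hl1).2
  have hl2 := (abs_lt.1 hl2).2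
  have hnpos : (1 : ℝ) ≤ n := by exact_mod_cast hn
  set H₁ := SimpleGraph.fromEdgeSet E₁ with hH1
  set H₂ := SimpleGraph.fromEdgeSet E₂ with hH2
  have hnd : ∀ u v, s(u, v) ∈ E₁ ∪ E₂ → u ≠ v := by
    intro u v h
    rw [hU, mem_edgeSet] at h
    exact h.ne
  have a1 : ∀ u v, H₁.Adj u v ↔ s(u, v) ∈ E₁ := fun u v => by
    rw [hH1, fromEdgeSet_adj]
    exact ⟨fun h => h.1, fun h => ⟨h, hnd _ _ (Or.inl h)⟩⟩
  have a2 : ∀ u v, H₂.Adj u v ↔ s(u, v) ∈ E₂ := fun u v => by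
    rw [hH2, fromEdgeSet_adj]
    exact ⟨fun h => h.1, fun h => ⟨h, hnd _ _ (Or.inr h)⟩⟩
  have a3 : ∀ u v, G.Adj u v ↔ H₁.Adj u v ∨ H₂.Adj u v := fun u v => by
    rw [a1, a2, ← mem_edgeSet, ← hU]; rfl
  have hle1 : H₁ ≤ G := fun u v h => (a3 u v).2 (Or.inl h)
  have hle2 : H₂ ≤ G := fun u v h => (a3 u v).2 (Or.inr h)
  have hdeg : ∀ v, H₁.degree v + H₂.degree v = 3 := by
    intro v
    rw [← hreg v, ← card_neighborFinset_eq_degree, ← card_neighborFinset_eq_degree,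
      ← card_neighborFinset_eq_degree, ← Finset.card_union_of_disjoint]
    · congr 1
      ext w
      simp [a3]
    · rw [Finset.disjoint_left]
      intro w h1 h2
      rw [mem_neighborFinset] at h1 h2
      exact Set.disjoint_left.1 hD ((a1 _ _).1 h1) ((a2 _ _).1 h2)
  have hcyc : ∀ H : SimpleGraph V, H ≤ G → ∀ (v : V) (w : H.Walk v v), w.IsCycle →
      128 / c ≤ w.length := by
    intro H hH v w hw
    have := egirth_le_length (hw.mapLe hH)
    have := hgirth _ this
    rw [Walk.length_map] at this
    exact this.le
  obtain ⟨T₁, t₁, hT1, hs1, hk1⟩ := aux_main H₁ (128 / c) (hcyc _ hle1)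
  obtain ⟨T₂, t₂, hT2, hs2, hk2⟩ := aux_main H₂ (128 / c) (hcyc _ hle2)
  have hs1 : ∑ v ∈ T₁, H₁.degree v + 2 * t₁ = 2 * T₁.card := by convert hs1
  have hs2 : ∑ v ∈ T₂, H₂.degree v + 2 * t₂ = 2 * T₂.card := by convert hs2
  have hk : ∀ x : ℝ, x * (128 / c) ≤ Fintype.card V → x ≤ c * n / 64 := by
    intro x hx
    rw [hcard] at hx
    push_cast at hx
    rw [mul_div_assoc', div_le_iff₀ hc0] at hx
    linarith
  have hk1 := hk _ hk1
  have hk2 := hk _ hk2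
  -- degree sums
  have hsumT1 : ∑ v ∈ T₁, H₁.degree v + ∑ v ∈ T₁, H₂.degree v = 3 * T₁.card := by
    rw [← Finset.sum_add_distrib, Finset.sum_congr rfl (fun v _ => hdeg v)]
    simp [mul_comm]
  have hsumW2 : ∑ v ∈ T₂ᶜ, H₂.degree v ≤ 3 * T₂ᶜ.card := by
    rw [mul_comm, ← smul_eq_mul]
    exact Finset.sum_le_card_nsmul _ _ _ (fun v _ => by have := hdeg v; omega)
  have hv1 : ∑ v ∈ T₁, H₂.degree v + ∑ v ∈ T₁ᶜ, H₂.degree v = ∑ v, H₂.degree v :=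
    Finset.sum_add_sum_compl _ _
  have hv2 : ∑ v ∈ T₂, H₂.degree v + ∑ v ∈ T₂ᶜ, H₂.degree v = ∑ v, H₂.degree v :=
    Finset.sum_add_sum_compl _ _
  have hc1' : T₁.card + T₁ᶜ.card = 2 * n := by rw [Finset.card_add_card_compl, hcard]
  have hc2' : T₂.card + T₂ᶜ.card = 2 * n := by rw [Finset.card_add_card_compl, hcard]
  set D := ∑ v ∈ T₁ᶜ, H₂.degree v with hDdef
  have key : D + T₁.card + T₂.card + 2 * t₁ + 2 * t₂ ≤ 6 * n := by omega
  have hta1 : t₁ ≤ T₁.card := by omega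
  have hta2 : t₂ ≤ T₂.card := by omega
  have hbd : ∀ S : Finset V, (S = T₁ ∨ S = T₁ᶜ) →
      Set.ncard {e : Sym2 V | e ∈ G.edgeSet ∧ ∃ u v : V, e = s(u, v) ∧ u ∈ S ∧ v ∉ S} ≤ D := by
    intro S hS
    have hsub : {e : Sym2 V | e ∈ G.edgeSet ∧ ∃ u v : V, e = s(u, v) ∧ u ∈ S ∧ v ∉ S} ⊆
        ((T₁ᶜ.biUnion fun v => (H₂.neighborFinset v).image fun w => s(v, w) : Finset (Sym2 V)) :
          Set (Sym2 V)) := by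
      rintro e ⟨he, u, v, rfl, hu, hv⟩
      rw [mem_edgeSet, a3] at he
      simp only [Finset.coe_biUnion, Set.mem_iUnion, Finset.mem_coe, Finset.mem_image,
        mem_neighborFinset, Finset.mem_compl]
      rcases hS with rfl | rfl
      · rcases he with he | he
        · exact absurd ((hT1 _ _ he).1 hu) hv
        · exact ⟨v, hv, u, he.symm, Sym2.eq_swap⟩
      · rw [Finset.mem_compl] at hu hv
        rw [not_not] at hv
        rcases he with he | he
        · exact absurd ((hT1 _ _ he).2 hv) hu
        · exact ⟨u, hu, v, he, rfl⟩
    refine (Set.ncard_le_ncard hsub (Finset.finite_toSet _)).trans ?_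
    rw [Set.ncard_coe_finset]
    refine Finset.card_biUnion_le.trans (Finset.sum_le_sum fun v _ => ?_)
    exact Finset.card_image_le.trans (card_neighborFinset_eq_degree _ _).le
  have keyR : (D : ℝ) + T₁.card + T₂.card + 2 * t₁ + 2 * t₂ ≤ 6 * n := by exact_mod_cast key
  have hta1R : (t₁ : ℝ) ≤ T₁.card := by exact_mod_cast hta1
  have hta2R : (t₂ : ℝ) ≤ T₂.card := by exact_mod_cast hta2
  have hcR : (T₁.card : ℝ) + T₁ᶜ.card = 2 * n := by exact_mod_cast hc1'
  have hD0 : (0 : ℝ) ≤ D := Nat.cast_nonneg _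
  have hcn : c * n ≤ n := by nlinarith
  have hcn0 : 0 < c * n := by positivity
  have fin : ∀ S : Finset V, (S = T₁ ∨ S = T₁ᶜ) → S.card ≤ n → (n : ℝ) / 2 ≤ S.card → False := by
    intro S hS h1 h2
    have h3 := hexp S h1
    have h4 : (Set.ncard {e : Sym2 V | e ∈ G.edgeSet ∧ ∃ u v : V, e = s(u, v) ∧ u ∈ S ∧ v ∉ S} : ℝ)
      ≤ D := by exact_mod_cast hbd S hS
    have h5 : c * (n / 2) ≤ c * S.card := mul_le_mul_of_nonneg_left h2 hc0.le
    linarith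
  rcases le_total T₁.card n with h | h
  · exact fin T₁ (Or.inl rfl) h (by linarith)
  · exact fin T₁ᶜ (Or.inr rfl) (by omega) (by linarith)
end

section
/- Let η and β be finite measures on a measurable space (X, Σ), let ρ : Σ → ℝ be a setfunction with β(A) ≤ ρ(A) for all A ∈ Σ, let g : X → ℝ be a bounded measurable function, and let F ∈ Σ be such that η(F ∩ {x : g(x) ≥ t}) = ρ({x : g(x) ≥ t}) for every t > 0. Then ∫_X g dβ ≤ ∫_{F ∩ {x : g(x) ≥ 0}} g dη. -/
open MeasureTheory Set

/-- Layer-cake comparison: if `β ≤ ρ` on measurable sets, `g` is bounded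
measurable, and `F` satisfies `η(F ∩ {g ≥ t}) = ρ({g ≥ t})` for all `t > 0`, then
`∫ g dβ ≤ ∫_{F ∩ {g ≥ 0}} g dη`. -/
theorem layer_cake_comparison
    {X : Type*} [MeasurableSpace X] (η β : Measure X)
    [IsFiniteMeasure η] [IsFiniteMeasure β]
    (ρ : Set X → ℝ)
    (hρ : ∀ A : Set X, MeasurableSet A → (β A).toReal ≤ ρ A)
    (g : X → ℝ) (hg : Measurable g) (C : ℝ) (hgC : ∀ x, |g x| ≤ C)
    (F : Set X) (hF : MeasurableSet F)
    (hlevel : ∀ t : ℝ, 0 < t → (η (F ∩ {x | t ≤ g x})).toReal = ρ {x | t ≤ g x}) :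
    ∫ x, g x ∂β ≤ ∫ x in F ∩ {x | 0 ≤ g x}, g x ∂η := by
  have hint : ∀ (μ : Measure X) [IsFiniteMeasure μ], Integrable g μ := fun μ _ =>
    Integrable.of_bound hg.aestronglyMeasurable C
      (Filter.Eventually.of_forall fun x => by simpa using hgC x)
  have hS : MeasurableSet (F ∩ {x | 0 ≤ g x}) :=
    hF.inter (measurableSet_le measurable_const hg)
  have hm : Measurable (fun x => max (g x) 0) := hg.max measurable_const
  have hmi : ∀ (μ : Measure X) [IsFiniteMeasure μ], Integrable (fun x => max (g x) 0) μ :=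
    fun μ _ => (hint μ).pos_part
  have h1 : ∫ x, g x ∂β ≤ ∫ x, max (g x) 0 ∂β :=
    integral_mono (hint β) (hmi β) fun x => le_max_left _ _
  have h2 : ∫ x in F ∩ {x | 0 ≤ g x}, g x ∂η = ∫ x in F ∩ {x | 0 ≤ g x}, max (g x) 0 ∂η :=
    setIntegral_congr_fun hS fun x hx => (max_eq_left hx.2).symm
  rw [h2]
  refine h1.trans ?_
  have nn : ∀ μ : Measure X, 0 ≤ᵐ[μ] fun x => max (g x) 0 := fun μ =>
    Filter.Eventually.of_forall fun x => le_max_right _ _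
  have h0 : 0 ≤ ∫ x in F ∩ {x | 0 ≤ g x}, max (g x) 0 ∂η := integral_nonneg_of_ae (nn _)
  rw [← ENNReal.ofReal_le_ofReal_iff h0,
    ofReal_integral_eq_lintegral_ofReal (hmi β) (nn _),
    ofReal_integral_eq_lintegral_ofReal (hmi (η.restrict (F ∩ {x | 0 ≤ g x}))) (nn _),
    lintegral_eq_lintegral_meas_le _ (nn _) hm.aemeasurable,
    lintegral_eq_lintegral_meas_le _ (nn _) hm.aemeasurable]
  refine setLIntegral_mono' measurableSet_Ioi fun t ht => ?_
  have ht : 0 < t := ht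
  have e : {x | t ≤ max (g x) 0} = {x | t ≤ g x} := by
    ext x
    simp [not_le.mpr ht]
  have hA : MeasurableSet {x | t ≤ g x} := measurableSet_le measurable_const hg
  have e2 : {x | t ≤ g x} ∩ (F ∩ {x | 0 ≤ g x}) = F ∩ {x | t ≤ g x} := by
    ext x
    simp only [mem_inter_iff, mem_setOf_eq]
    constructor
    · rintro ⟨a, b, -⟩
      exact ⟨b, a⟩
    · rintro ⟨a, b⟩
      exact ⟨b, a, ht.le.trans b⟩
  rw [e, Measure.restrict_apply hA, e2,
    ← ENNReal.toReal_le_toReal (measure_ne_top _ _) (measure_ne_top _ _), hlevel t ht]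
  exact hρ _ hA
end
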